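/- Let P be a monic irreducible polynomial in F_q[T] of degree m and let n ≥ 1; set r = mn + 1. Then P divides F_{q,m−1} in F_q[T] if and only if the image of P in F_{q^r}[T] divides F_{q^r,m−1} in F_{q^r}[T]. In other words, P is a c-Wieferich prime in F_q[T] if and only if P is a c-Wieferich prime in F_{q^{mn+1}}[T]. -/

import Mathlib

open Polynomial

/-- The sequence of polynomials `F_{Q,0} = 1`, `F_{Q,i} = (−1)^i + (T^{Q^i} − T)·F_{Q,i−1}`. -/
noncomputable def Fseq (q : ℕ) (K : Type*) [Field K] : ℕ → Polynomial K
  | 0 => 1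
  | i + 1 => (-1 : Polynomial K) ^ (i + 1) + (X ^ q ^ (i + 1) - X) * Fseq q K i

theorem Fseq_map (q : ℕ) {F K : Type*} [Field F] [Field K] (f : F →+* K) (i : ℕ) :
    (Fseq q F i).map f = Fseq q K i := by
  induction i with
  | zero => simp [Fseq]
  | succ i ih => simp [Fseq, ih]

theorem dvd_X_pow_card_pow_sub_of_irreducible {F : Type*} [Field F] [Finite F] {P : F[X]}
    (hP : Irreducible P) (n i : ℕ) :
    P ∣ X ^ (Nat.card F ^ (P.natDegree * n + 1)) ^ i - X ^ Nat.card F ^ i := by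
  have h : P ∣ X ^ Nat.card F ^ (P.natDegree * n * i) - X :=
    hP.natDegree_dvd_iff_dvd_X_pow_card_pow_sub_X.mp ⟨n * i, by ring⟩
  have hexp : (Nat.card F ^ (P.natDegree * n + 1)) ^ i =
      Nat.card F ^ (P.natDegree * n * i) * Nat.card F ^ i := by ring
  rw [hexp, pow_mul]
  exact h.trans (sub_dvd_pow_sub_pow _ _ _)

/-- If `T ^ (Q ^ i) ≡ T ^ (q ^ i)` modulo `P` for all `i`, then `F_{Q,i} ≡ F_{q,i}` modulo `P`. -/
theorem dvd_Fseq_sub_Fseq {F : Type*} [Field F] {P : F[X]} {Q q : ℕ}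
    (h : ∀ i, P ∣ X ^ Q ^ i - X ^ q ^ i) (i : ℕ) : P ∣ Fseq Q F i - Fseq q F i := by
  induction i with
  | zero => simp [Fseq]
  | succ i ih =>
    have key : Fseq Q F (i + 1) - Fseq q F (i + 1) =
        (X ^ Q ^ (i + 1) - X ^ q ^ (i + 1)) * Fseq Q F i +
          (X ^ q ^ (i + 1) - X) * (Fseq Q F i - Fseq q F i) := by
      simp only [Fseq]
      ring
    rw [key]
    exact dvd_add ((h (i + 1)).mul_right _) (ih.mul_left _)

/-- Let `P` be a monic irreducible polynomial in `F_q[T]` of degree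
`m`, let `n ≥ 1` and set `r = mn + 1`.  Then `P` divides `F_{q,m−1}` in `F_q[T]` if and
only if the image of `P` in `F_{q^r}[T]` divides `F_{q^r,m−1}` in `F_{q^r}[T]`; i.e.
`P` is a c-Wieferich prime in `F_q[T]` iff it is one in `F_{q^{mn+1}}[T]`. -/
theorem stmt9 (q m n : ℕ) (hn : 1 ≤ n)
    (F K : Type*) [Field F] [Fintype F] [Field K] [Fintype K] [Algebra F K]
    (hF : Fintype.card F = q) (hK : Module.finrank F K = m * n + 1)
    (P : Polynomial F) (hmon : P.Monic) (hirr : Irreducible P)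
    (hdeg : P.natDegree = m) :
    P ∣ Fseq q F (m - 1) ↔
      P.map (algebraMap F K) ∣ Fseq (q ^ (m * n + 1)) K (m - 1) := by
  subst hdeg hF
  rw [← Fseq_map _ (algebraMap F K), map_dvd_map', ← Nat.card_eq_fintype_card]
  exact (dvd_iff_dvd_of_dvd_sub
    (dvd_Fseq_sub_Fseq (dvd_X_pow_card_pow_sub_of_irreducible hirr n) _)).symm
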